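/- (Main property of the Gabriel–Roiter measure, second part) Let X, Y₁, …, Yₙ be indecomposable finite-dimensional Λ-modules, let m be an index with μ(Y_m) = max{μ(Y_i) : 1 ≤ i ≤ n} in the lexicographical order, and let f = (f₁, …, fₙ) : X → Y₁ ⊕ ⋯ ⊕ Yₙ be an injective Λ-module homomorphism with components f_i : X → Y_i. If μ(X) = μ(Y_m), then there exists an index s such that f_s : X → Y_s is an isomorphism (and hence μ(Y_s) = μ(Y_m)). -/

import Mathlib

noncomputable section

/-- The lexicographical order on finite subsets of `ℕ`: `X ≤ Y` iff
`min (Y \ X) ≤ min (X \ Y)`, where the minimum of the empty set is `+∞`. -/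
def lexLe (X Y : Finset ℕ) : Prop := (Y \ X).min ≤ (X \ Y).min

/-- The strict lexicographical order on finite subsets of `ℕ`. -/
def lexLt (X Y : Finset ℕ) : Prop := lexLe X Y ∧ X ≠ Y

/-- A module `M` is indecomposable if `M ≠ 0` and `M` is not the direct sum of two
nonzero submodules. -/
def IsIndecomposableModule (Λ : Type*) [Ring Λ] (M : Type*) [AddCommGroup M]
    [Module Λ M] : Prop :=
  Nontrivial M ∧ ∀ N₁ N₂ : Submodule Λ M, IsCompl N₁ N₂ → N₁ = ⊥ ∨ N₂ = ⊥

open Classical in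
/-- The composition length `ℓ(M)` of a module `M`: the length of a composition series of
submodules from `⊥` to `⊤` (well defined by the Jordan–Hölder theorem; junk value `0` if
no composition series exists). -/
def compLength (Λ : Type*) [Ring Λ] (M : Type*) [AddCommGroup M] [Module Λ M] : ℕ :=
  if h : ∃ s : CompositionSeries (Submodule Λ M), s.head = ⊥ ∧ s.last = ⊤ then
    h.choose.length else 0

/-- A Gabriel–Roiter chain ending at `M`: a finite set of submodules of `M`, totally ordered
by inclusion (hence a chain `M₁ ⊂ M₂ ⊂ ⋯ ⊂ M_t` with strict inclusions), containing
`M_t = M` itself (the top submodule), all of whose members are indecomposable. -/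
def IsGRChain (Λ : Type*) [Ring Λ] {M : Type*} [AddCommGroup M] [Module Λ M]
    (C : Finset (Submodule Λ M)) : Prop :=
  (⊤ : Submodule Λ M) ∈ C ∧ (∀ N₁ ∈ C, ∀ N₂ ∈ C, N₁ ≤ N₂ ∨ N₂ ≤ N₁) ∧
    ∀ N ∈ C, IsIndecomposableModule Λ ↥N

/-- `S` is the Gabriel–Roiter measure `μ(M)` of `M`: `S` is the set `{ℓ(M₁), …, ℓ(M_t)}`
of composition lengths along some Gabriel–Roiter chain ending at `M`, and is
lexicographically greatest among all such sets. -/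
def IsGRMeasureOf (Λ : Type*) [Ring Λ] (M : Type*) [AddCommGroup M] [Module Λ M]
    (S : Finset ℕ) : Prop :=
  (∃ C : Finset (Submodule Λ M), IsGRChain Λ C ∧
      C.image (fun N : Submodule Λ M => compLength Λ ↥N) = S) ∧
  ∀ C : Finset (Submodule Λ M), IsGRChain Λ C →
      lexLe (C.image (fun N : Submodule Λ M => compLength Λ ↥N)) S

section LexOrder

/-- The indicator sequence of a finite set of naturals, as an element of a lexicographically
ordered product. -/
def lexIndicator (X : Finset ℕ) : Lex (ℕ → Bool) := toLex fun n => decide (n ∈ X)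

theorem lexIndicator_injective : Function.Injective lexIndicator := by
  intro X Y h
  ext n
  have := congrFun (toLex.injective h) n
  simpa using this

theorem lexIndicator_lt_iff {X Y : Finset ℕ} :
    lexIndicator X < lexIndicator Y ↔
      ∃ a, (∀ b < a, (b ∈ X ↔ b ∈ Y)) ∧ a ∉ X ∧ a ∈ Y := by
  change (∃ a, (∀ b < a, decide (b ∈ X) = decide (b ∈ Y)) ∧ decide (a ∈ X) < decide (a ∈ Y)) ↔ _
  simp [Bool.lt_iff]

theorem lexLe_iff_lexIndicator_le {X Y : Finset ℕ} :
    lexLe X Y ↔ lexIndicator X ≤ lexIndicator Y := by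
  have lexLe_of_lt {X Y : Finset ℕ} (h : lexIndicator X < lexIndicator Y) :
      lexLe X Y ∧ ¬ lexLe Y X := by
    obtain ⟨a, hb, haX, haY⟩ := lexIndicator_lt_iff.1 h
    have hlt : (Y \ X).min < (X \ Y).min := by
      refine (Finset.min_le (Finset.mem_sdiff.2 ⟨haY, haX⟩)).trans_lt ?_
      rw [Finset.min_eq_inf_withTop, Finset.lt_inf_iff (WithTop.coe_lt_top a)]
      intro b hbXY
      rw [Finset.mem_sdiff] at hbXY
      refine WithTop.coe_lt_coe.2 (lt_of_not_ge fun hba => ?_)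
      rcases hba.lt_or_eq with hba | rfl
      · exact hbXY.2 ((hb b hba).1 hbXY.1)
      · exact haX hbXY.1
    exact ⟨hlt.le, hlt.not_ge⟩
  rcases lt_trichotomy (lexIndicator X) (lexIndicator Y) with h | h | h
  · exact iff_of_true (lexLe_of_lt h).1 h.le
  · rw [lexIndicator_injective h]
    exact iff_of_true le_rfl le_rfl
  · exact iff_of_false (lexLe_of_lt h).2 h.not_ge

theorem lexIndicator_le_insert (a : ℕ) (X : Finset ℕ) :
    lexIndicator X ≤ lexIndicator (insert a X) := by
  rw [← lexLe_iff_lexIndicator_le, lexLe, Finset.sdiff_eq_empty_iff_subset.2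
    (Finset.subset_insert a X), Finset.min_empty]
  exact le_top

theorem lexIndicator_lt_insert {a : ℕ} {X : Finset ℕ} (ha : a ∉ X) :
    lexIndicator X < lexIndicator (insert a X) :=
  (lexIndicator_le_insert a X).lt_of_ne fun h =>
    ha (lexIndicator_injective h ▸ Finset.mem_insert_self a X)

theorem lexIndicator_insert_lt {a : ℕ} {X Y : Finset ℕ} (h : lexIndicator X < lexIndicator Y)
    (hY : ∀ b ∈ Y, b < a) : lexIndicator (insert a X) < lexIndicator Y := by
  obtain ⟨c, hb, hcX, hcY⟩ := lexIndicator_lt_iff.1 h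
  have hca := hY c hcY
  refine lexIndicator_lt_iff.2 ⟨c, fun b hbc => ?_, ?_, hcY⟩
  · simp [hb b hbc, (hbc.trans hca).ne]
  · simp [hcX, hca.ne]

end LexOrder

section Length

variable {Λ : Type*} [Ring Λ] {M N : Type*} [AddCommGroup M] [Module Λ M]
  [AddCommGroup N] [Module Λ N]

theorem compLength_eq_toNat_length [IsNoetherian Λ M] [IsArtinian Λ M] :
    compLength Λ M = (Module.length Λ M).toNat := by
  have h : ∃ s : CompositionSeries (Submodule Λ M), s.head = ⊥ ∧ s.last = ⊤ :=
    exists_compositionSeries_of_isNoetherian_isArtinian Λ M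
  rw [compLength, dif_pos h,
    ← Module.length_compositionSeries h.choose h.choose_spec.1 h.choose_spec.2, ENat.toNat_natCast]

theorem coe_compLength [IsNoetherian Λ M] [IsArtinian Λ M] :
    (compLength Λ M : ℕ∞) = Module.length Λ M := by
  rw [compLength_eq_toNat_length, ENat.natCast_toNat Module.length_ne_top]

theorem LinearEquiv.compLength_eq [IsNoetherian Λ M] [IsArtinian Λ M] (e : M ≃ₗ[Λ] N) :
    compLength Λ M = compLength Λ N := by
  have := isNoetherian_of_linearEquiv e
  have := isArtinian_of_linearEquiv e
  rw [compLength_eq_toNat_length, compLength_eq_toNat_length, e.length_eq]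

theorem compLength_submodule_lt [IsNoetherian Λ M] [IsArtinian Λ M] {P : Submodule Λ M}
    (h : P ≠ ⊤) : compLength Λ P < compLength Λ M := by
  rw [← Nat.cast_lt (α := ℕ∞), coe_compLength, coe_compLength]
  exact Submodule.length_lt h

theorem compLength_submodule_le [IsNoetherian Λ M] [IsArtinian Λ M] (P : Submodule Λ M) :
    compLength Λ P ≤ compLength Λ M := by
  rw [← Nat.cast_le (α := ℕ∞), coe_compLength, coe_compLength]
  exact Module.length_le_of_injective P.subtype P.subtype_injective

theorem compLength_top [IsNoetherian Λ M] [IsArtinian Λ M] :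
    compLength Λ (⊤ : Submodule Λ M) = compLength Λ M :=
  Submodule.topEquiv.compLength_eq

theorem compLength_lt_of_surjective [IsNoetherian Λ M] [IsArtinian Λ M] {g : M →ₗ[Λ] N}
    (hg : Function.Surjective g) (hg' : ¬ Function.Bijective g) :
    compLength Λ N < compLength Λ M := by
  have := isNoetherian_of_surjective g (LinearMap.range_eq_top.2 hg)
  have := isArtinian_of_surjective M g hg
  have hadd := Module.length_eq_add_of_exact (LinearMap.ker g).subtype g
    (Submodule.subtype_injective _) hg (LinearMap.exact_subtype_ker_map g)
  rw [← coe_compLength, ← coe_compLength, ← coe_compLength, ← Nat.cast_add, Nat.cast_inj] at hadd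
  have hker : Nontrivial (LinearMap.ker g) := by
    rw [Submodule.nontrivial_iff_ne_bot]
    exact fun h => hg' ⟨LinearMap.ker_eq_bot.1 h, hg⟩
  have hpos : 0 < compLength Λ (LinearMap.ker g) := by
    rw [← Nat.cast_pos (α := ℕ∞), coe_compLength]
    exact Module.length_pos
  omega

end Length

section Indecomposable

variable {Λ : Type*} [Ring Λ] {M N : Type*} [AddCommGroup M] [Module Λ M]
  [AddCommGroup N] [Module Λ N]

theorem IsIndecomposableModule.of_linearEquiv (h : IsIndecomposableModule Λ M)
    (e : M ≃ₗ[Λ] N) : IsIndecomposableModule Λ N := by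
  have := h.1
  refine ⟨e.symm.toEquiv.nontrivial, fun P Q hPQ => ?_⟩
  have hcompl := hPQ.map (Submodule.orderIsoMapComap e.symm)
  refine (h.2 _ _ hcompl).imp (fun hP => ?_) fun hQ => ?_
  · simpa using hP
  · simpa using hQ

/-- A nonzero element of a module of finite length survives in some indecomposable direct
summand. -/
theorem exists_indecomposable_summand [IsNoetherian Λ M] [IsArtinian Λ M] {w : M} (hw : w ≠ 0) :
    ∃ (Z : Submodule Λ M) (p : M →ₗ[Λ] Z), IsIndecomposableModule Λ Z ∧
      Function.Surjective p ∧ p w ≠ 0 := by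
  have key : ∀ W : Submodule Λ M, ∀ q : M →ₗ[Λ] W, Function.Surjective q → q w ≠ 0 →
      ∃ (Z : Submodule Λ M) (p : M →ₗ[Λ] Z), IsIndecomposableModule Λ Z ∧
        Function.Surjective p ∧ p w ≠ 0 := by
    intro W
    induction W using WellFoundedLT.induction with
    | _ W ih =>
      intro q hq hqw
      by_cases hW : IsIndecomposableModule Λ W
      · exact ⟨W, q, hW, hq, hqw⟩
      have hnt : Nontrivial W := ⟨⟨_, _, hqw⟩⟩
      simp only [IsIndecomposableModule, hnt, true_and, not_forall, not_or] at hW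
      obtain ⟨A, B, hAB, hA, hB⟩ := hW
      have descend {A B : Submodule Λ W} (hAB : IsCompl A B) (hB : B ≠ ⊥) (hwB : q w ∉ B) :
          ∃ (Z : Submodule Λ M) (p : M →ₗ[Λ] Z), IsIndecomposableModule Λ Z ∧
            Function.Surjective p ∧ p w ≠ 0 := by
        let e := Submodule.equivMapOfInjective W.subtype W.subtype_injective A
        have hlt : A.map W.subtype < W := by
          refine (Submodule.map_subtype_le W A).lt_of_ne fun h => hB ?_
          have hA : A = ⊤ := by
            apply Submodule.map_injective_of_injective W.subtype_injective
            rw [h, Submodule.map_subtype_top]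
          simpa [hA] using hAB.disjoint
        refine ih _ hlt (e.toLinearMap ∘ₗ A.projectionOnto B hAB ∘ₗ q) ?_ ?_
        · exact e.surjective.comp ((Submodule.projectionOnto_surjective hAB).comp hq)
        · simpa using hwB
      by_cases hwB : q w ∈ B
      · refine descend hAB.symm hA fun hwA => hqw ?_
        exact Submodule.disjoint_def.1 hAB.disjoint _ hwA hwB
      · exact descend hAB hB hwB
  exact key ⊤ Submodule.topEquiv.symm.toLinearMap Submodule.topEquiv.symm.surjective (by simpa)

/-- An element outside the kernel of a map to a module of finite length survives in some
indecomposable submodule of the target onto which the source maps through the given map. -/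
theorem exists_indecomposable_factor [IsNoetherian Λ N] [IsArtinian Λ N] (f : M →ₗ[Λ] N) {x : M}
    (hx : f x ≠ 0) :
    ∃ (Z : Submodule Λ N) (g : M →ₗ[Λ] Z), IsIndecomposableModule Λ Z ∧
      Function.Surjective g ∧ LinearMap.ker f ≤ LinearMap.ker g ∧ g x ≠ 0 := by
  have hw : f.rangeRestrict x ≠ 0 := fun h => hx (congrArg Subtype.val h)
  obtain ⟨Z, p, hZ, hp, hpw⟩ := exists_indecomposable_summand (Λ := Λ) hw
  let e := Submodule.equivMapOfInjective (LinearMap.range f).subtype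
    (Submodule.subtype_injective _) Z
  refine ⟨_, e.toLinearMap ∘ₗ p ∘ₗ f.rangeRestrict, hZ.of_linearEquiv e, ?_, ?_, ?_⟩
  · exact e.surjective.comp (hp.comp f.surjective_rangeRestrict)
  · rw [LinearEquiv.ker_comp, ← LinearMap.ker_rangeRestrict f]
    exact LinearMap.ker_le_ker_comp _ _
  · simpa using hpw

/-- A surjection from `X` onto an indecomposable submodule of some `Y i` which factors through
the image of `f i`. -/
structure IndecomposableFactor {ι : Type*} {Y : ι → Type*} [∀ i, AddCommGroup (Y i)]
    [∀ i, Module Λ (Y i)] (f : ∀ i, M →ₗ[Λ] Y i) where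
  /-- The index of the target. -/
  index : ι
  /-- The indecomposable submodule. -/
  target : Submodule Λ (Y index)
  /-- The surjection. -/
  map : M →ₗ[Λ] target
  indecomposable : IsIndecomposableModule Λ target
  surjective : Function.Surjective map
  ker_le : LinearMap.ker (f index) ≤ LinearMap.ker map

theorem IsIndecomposableModule.bijective_of_bijective_restrict (h : IsIndecomposableModule Λ M)
    {g : M →ₗ[Λ] N} {P : Submodule Λ M} [Nontrivial P]
    (hg : Function.Bijective (g ∘ₗ P.subtype)) : Function.Bijective g := by
  let e := LinearEquiv.ofBijective _ hg
  have hcompl : IsCompl P (LinearMap.ker (e.symm.toLinearMap ∘ₗ g)) :=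
    LinearMap.isCompl_of_proj fun x => e.symm_apply_apply x
  rw [LinearEquiv.ker_comp] at hcompl
  refine ⟨LinearMap.ker_eq_bot.1 ((h.2 _ _ hcompl).resolve_left ?_), ?_⟩
  · exact P.nontrivial_iff_ne_bot.1 inferInstance
  · exact Function.Surjective.of_comp hg.2

end Indecomposable

section Chains

variable {Λ : Type*} [Ring Λ] {M N : Type*} [AddCommGroup M] [Module Λ M]
  [AddCommGroup N] [Module Λ N]

/-- The set of composition lengths of the members of a finite set of submodules. -/
abbrev lengthSet (C : Finset (Submodule Λ M)) : Finset ℕ :=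
  C.image fun P : Submodule Λ M => compLength Λ ↥P

theorem le_compLength_of_mem_lengthSet [IsNoetherian Λ M] [IsArtinian Λ M]
    {C : Finset (Submodule Λ M)} {a : ℕ} (ha : a ∈ lengthSet C) : a ≤ compLength Λ M := by
  obtain ⟨P, -, rfl⟩ := Finset.mem_image.1 ha
  exact compLength_submodule_le P

theorem IsGRChain.compLength_mem_lengthSet [IsNoetherian Λ M] [IsArtinian Λ M]
    {C : Finset (Submodule Λ M)} (hC : IsGRChain Λ C) : compLength Λ M ∈ lengthSet C :=
  Finset.mem_image.2 ⟨⊤, hC.1, compLength_top⟩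

theorem isGRChain_singleton_top (h : IsIndecomposableModule Λ M) :
    IsGRChain Λ ({⊤} : Finset (Submodule Λ M)) := by
  refine ⟨by simp, by simp, fun P hP => ?_⟩
  rw [Finset.mem_singleton.1 hP]
  exact h.of_linearEquiv Submodule.topEquiv.symm

/-- Chains can be pushed forward along injective maps to indecomposable modules. -/
theorem IsGRChain.exists_map [IsNoetherian Λ M] [IsArtinian Λ M]
    [IsNoetherian Λ N] [IsArtinian Λ N] {C : Finset (Submodule Λ M)} (hC : IsGRChain Λ C)
    (hN : IsIndecomposableModule Λ N) {φ : M →ₗ[Λ] N} (hφ : Function.Injective φ) :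
    ∃ D : Finset (Submodule Λ N), IsGRChain Λ D ∧
      lengthSet D = insert (compLength Λ N) (lengthSet C) := by
  classical
  refine ⟨insert ⊤ (C.image (Submodule.map φ)), ⟨Finset.mem_insert_self _ _, ?_, ?_⟩, ?_⟩
  · simp only [Finset.mem_insert, Finset.mem_image]
    rintro _ (rfl | ⟨P, hP, rfl⟩) _ (rfl | ⟨Q, hQ, rfl⟩)
    · exact Or.inl le_rfl
    · exact Or.inr le_top
    · exact Or.inl le_top
    · exact (hC.2.1 P hP Q hQ).imp (Submodule.map_mono ·) (Submodule.map_mono ·)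
  · simp only [Finset.mem_insert, Finset.mem_image]
    rintro _ (rfl | ⟨P, hP, rfl⟩)
    · exact hN.of_linearEquiv Submodule.topEquiv.symm
    · exact (hC.2.2 P hP).of_linearEquiv (Submodule.equivMapOfInjective φ hφ P)
  · rw [lengthSet, Finset.image_insert, compLength_top, Finset.image_image]
    congr 1
    refine Finset.image_congr fun P _ => ?_
    exact (Submodule.equivMapOfInjective φ hφ P).compLength_eq.symm

/-- A chain is either trivial or obtained by adding the top to a chain of a proper submodule. -/
theorem IsGRChain.eq_singleton_or_exists [IsNoetherian Λ M] [IsArtinian Λ M]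
    {C : Finset (Submodule Λ M)} (hC : IsGRChain Λ C) :
    lengthSet C = {compLength Λ M} ∨
      ∃ (P : Submodule Λ M) (D : Finset (Submodule Λ P)), P ≠ ⊤ ∧ IsIndecomposableModule Λ P ∧
        IsGRChain Λ D ∧ lengthSet C = insert (compLength Λ M) (lengthSet D) := by
  classical
  have hset : lengthSet C = insert (compLength Λ M) (lengthSet (C.erase ⊤)) := by
    conv_lhs => rw [← Finset.insert_erase hC.1]
    rw [lengthSet, Finset.image_insert, compLength_top]
  rcases (C.erase ⊤).eq_empty_or_nonempty with h | h
  · left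
    simp [hset, h]
  right
  obtain ⟨P, hP, hmax⟩ := (C.erase ⊤).exists_maximal h
  have hle : ∀ Q ∈ C.erase ⊤, Q ≤ P := fun Q hQ =>
    (hC.2.1 Q (Finset.mem_of_mem_erase hQ) P (Finset.mem_of_mem_erase hP)).elim id (hmax hQ)
  refine ⟨P, (C.erase ⊤).image fun Q => Q.submoduleOf P, Finset.ne_of_mem_erase hP,
    hC.2.2 P (Finset.mem_of_mem_erase hP), ⟨?_, ?_, ?_⟩, ?_⟩
  · exact Finset.mem_image.2 ⟨P, hP, Submodule.submoduleOf_self P⟩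
  · simp only [Finset.mem_image]
    rintro _ ⟨Q, hQ, rfl⟩ _ ⟨R, hR, rfl⟩
    exact (hC.2.1 Q (Finset.mem_of_mem_erase hQ) R (Finset.mem_of_mem_erase hR)).imp
      (Submodule.comap_mono ·) (Submodule.comap_mono ·)
  · simp only [Finset.mem_image]
    rintro _ ⟨Q, hQ, rfl⟩
    exact (hC.2.2 Q (Finset.mem_of_mem_erase hQ)).of_linearEquiv
      (Submodule.submoduleOfEquivOfLe (hle Q hQ)).symm
  · rw [hset]
    congr 1
    rw [lengthSet, lengthSet, Finset.image_image]
    refine Finset.image_congr fun Q hQ => ?_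
    exact (Submodule.submoduleOfEquivOfLe (hle Q hQ)).symm.compLength_eq

end Chains

section MainProperty

universe u v

variable {Λ : Type u} [Ring Λ]

/-- If (possibly infinitely many) maps from `X` to indecomposable modules are jointly
injective, then one of them is bijective, or every Gabriel–Roiter chain of `X` is strictly
dominated by one of some target. -/
theorem IsGRChain.exists_lt_or_exists_bijective {X : Type v} [AddCommGroup X] [Module Λ X]
    [IsNoetherian Λ X] [IsArtinian Λ X] (hX : IsIndecomposableModule Λ X)
    {C : Finset (Submodule Λ X)} (hC : IsGRChain Λ C)
    {ι : Type v} {Y : ι → Type v} [∀ i, AddCommGroup (Y i)] [∀ i, Module Λ (Y i)]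
    [∀ i, IsNoetherian Λ (Y i)] [∀ i, IsArtinian Λ (Y i)]
    (hY : ∀ i, IsIndecomposableModule Λ (Y i)) (f : ∀ i, X →ₗ[Λ] Y i)
    (hf : ∀ x, x ≠ 0 → ∃ i, f i x ≠ 0) :
    (∃ (i : ι) (D : Finset (Submodule Λ (Y i))), IsGRChain Λ D ∧
      lexIndicator (lengthSet C) < lexIndicator (lengthSet D)) ∨
    ∃ i, Function.Bijective (f i) := by
  have hg : ∀ x, x ≠ 0 → ∃ t : IndecomposableFactor f, t.map x ≠ 0 := by
    intro x hx
    obtain ⟨i, hi⟩ := hf x hx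
    obtain ⟨Z, g, hZ, hg, hker, hgx⟩ := exists_indecomposable_factor (f i) hi
    exact ⟨⟨i, Z, g, hZ, hg, hker⟩, hgx⟩
  by_cases hbij : ∃ t : IndecomposableFactor f, Function.Bijective t.map
  · obtain ⟨t, ht⟩ := hbij
    have hinj : Function.Injective (f t.index) :=
      LinearMap.ker_eq_bot.1 (le_bot_iff.1 (t.ker_le.trans (LinearMap.ker_eq_bot.2 ht.1).le))
    by_cases hsurj : Function.Surjective (f t.index)
    · exact Or.inr ⟨_, hinj, hsurj⟩
    left
    obtain ⟨D, hD, hDC⟩ := hC.exists_map (hY t.index) hinj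
    refine ⟨t.index, D, hD, hDC ▸ lexIndicator_lt_insert fun hmem => ?_⟩
    have hle := le_compLength_of_mem_lengthSet hmem
    rw [(LinearEquiv.ofInjective _ hinj).compLength_eq] at hle
    exact hle.not_gt (compLength_submodule_lt (mt LinearMap.range_eq_top.1 hsurj))
  left
  have extend (t : IndecomposableFactor f) {D : Finset (Submodule Λ t.target)}
      (hD : IsGRChain Λ D) {S : Finset ℕ}
      (hS : lengthSet C = insert (compLength Λ X) S)
      (hlt : lexIndicator S < lexIndicator (lengthSet D)) :
      ∃ (i : ι) (D : Finset (Submodule Λ (Y i))), IsGRChain Λ D ∧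
        lexIndicator (lengthSet C) < lexIndicator (lengthSet D) := by
    obtain ⟨E, hE, hED⟩ := hD.exists_map (hY t.index)
      t.target.subtype_injective
    refine ⟨t.index, E, hE, ?_⟩
    rw [hS, hED]
    refine (lexIndicator_insert_lt hlt fun b hb => ?_).trans_le (lexIndicator_le_insert _ _)
    exact (le_compLength_of_mem_lengthSet hb).trans_lt
      (compLength_lt_of_surjective (t.surjective) fun h => hbij ⟨t, h⟩)
  rcases hC.eq_singleton_or_exists with hS | ⟨P, D, hPtop, hP, hD, hS⟩
  · have := hX.1
    obtain ⟨x, hx⟩ := exists_ne (0 : X)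
    obtain ⟨t, -⟩ := hg x hx
    refine extend t (isGRChain_singleton_top t.indecomposable) (S := ∅) (by rw [hS]; rfl) ?_
    rw [lengthSet, Finset.image_singleton]
    exact lexIndicator_lt_insert (Finset.notMem_empty _)
  · have := hP.1
    rcases hD.exists_lt_or_exists_bijective hP (fun t : IndecomposableFactor f => t.indecomposable)
      (fun t => t.map ∘ₗ P.subtype)
      (fun x hx => hg x (by simpa using hx)) with ⟨t, E, hE, hlt⟩ | ⟨t, ht⟩
    · exact extend t hE hS hlt
    · exact absurd ⟨t, hX.bijective_of_bijective_restrict ht⟩ hbij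
termination_by compLength Λ X
decreasing_by exact compLength_submodule_lt hPtop

end MainProperty

/-- (Main property of the Gabriel–Roiter measure, second part) Let `X, Y₁, …, Yₙ` be
indecomposable finite-dimensional `Λ`-modules, `m` an index with `μ(Y_m)` lexicographically
maximal among the `μ(Y_i)`, and `f = (f₁, …, fₙ) : X → Y₁ ⊕ ⋯ ⊕ Yₙ` an injective
`Λ`-linear map. If `μ(X) = μ(Y_m)`, then some component `f_s : X → Y_s` is an isomorphism
(and hence `μ(Y_s) = μ(Y_m)`). -/
theorem grMeasure_main_property_iso (k : Type) [Field k] (Λ : Type) [Ring Λ]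
    [Algebra k Λ] [FiniteDimensional k Λ]
    (X : Type) [AddCommGroup X] [Module Λ X] [Module k X] [IsScalarTower k Λ X]
    [FiniteDimensional k X] (hX : IsIndecomposableModule Λ X)
    (n : ℕ) (Y : Fin n → Type) [∀ i, AddCommGroup (Y i)] [∀ i, Module Λ (Y i)]
    [∀ i, Module k (Y i)] [∀ i, IsScalarTower k Λ (Y i)] [∀ i, FiniteDimensional k (Y i)]
    (hY : ∀ i, IsIndecomposableModule Λ (Y i))
    (S : Finset ℕ) (hS : IsGRMeasureOf Λ X S)
    (T : Fin n → Finset ℕ) (hT : ∀ i, IsGRMeasureOf Λ (Y i) (T i))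
    (m : Fin n) (hm : ∀ i, lexLe (T i) (T m))
    (f : X →ₗ[Λ] ∀ i, Y i) (hf : Function.Injective f)
    (heq : S = T m) :
    ∃ s : Fin n, Function.Bijective ((LinearMap.proj s).comp f) ∧ T s = T m := by
  have : IsNoetherian Λ X := isNoetherian_of_tower k inferInstance
  have : IsArtinian Λ X := isArtinian_of_tower k inferInstance
  have : ∀ i, IsNoetherian Λ (Y i) := fun i => isNoetherian_of_tower k inferInstance
  have : ∀ i, IsArtinian Λ (Y i) := fun i => isArtinian_of_tower k inferInstance
  obtain ⟨⟨C, hC, rfl⟩, -⟩ := hS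
  have hf' : ∀ x, x ≠ 0 → ∃ i, (LinearMap.proj i).comp f x ≠ 0 := by
    intro x hx
    by_contra! h
    exact hx (hf (by rw [map_zero]; exact funext h))
  rcases hC.exists_lt_or_exists_bijective hX hY (fun i => (LinearMap.proj i).comp f) hf' with
    ⟨i, D, hD, hlt⟩ | ⟨s, hs⟩
  · have hle := lexLe_iff_lexIndicator_le.1 ((hT i).2 D hD)
    rw [lengthSet, heq] at hlt
    exact absurd (hlt.trans_le (hle.trans (lexLe_iff_lexIndicator_le.1 (hm i)))) (lt_irrefl _)
  · obtain ⟨D, hD, hDC⟩ := hC.exists_map (hY s) hs.1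
    rw [← (LinearEquiv.ofBijective _ hs).compLength_eq,
      Finset.insert_eq_of_mem hC.compLength_mem_lengthSet, lengthSet, lengthSet, heq] at hDC
    have hle := lexLe_iff_lexIndicator_le.1 ((hT s).2 D hD)
    rw [hDC] at hle
    exact ⟨s, hs, lexIndicator_injective ((lexLe_iff_lexIndicator_le.1 (hm s)).antisymm hle)⟩
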